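/- Let T, Q be finite sets and let A be a T×Q-matrix with integer entries. Then all entries of A^≀(s,s) are integers. -/

import Mathlib

open scoped BigOperators
open Classical

noncomputable section

/-- The number of maps `f` from the (indexed) parts of `mu` to the parts of `lam` such that for
every part `lam_i` of `lam`, the sum of the parts of `mu` in the fibre `f⁻¹(i)` equals `lam_i`.
This is `|𝓜_{λμ}|` and also the value of the permutation character `h_λ` on the class of cycle
type `μ`. -/
def Mcount (lam mu : Multiset ℕ) : ℕ :=
  Fintype.card {f : Fin (Multiset.card mu) → Fin (Multiset.card lam) //
    ∀ i : Fin (Multiset.card lam),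
      (∑ j ∈ Finset.univ.filter (fun j => f j = i), (mu.sort (· ≤ ·)).getD j 0)
        = (lam.sort (· ≤ ·)).getD i 0}

/-- `z_λ = ∏_i i^{m_i(λ)} m_i(λ)!`. -/
def zMult (lam : Multiset ℕ) : ℕ :=
  ∏ i ∈ lam.toFinset, i ^ lam.count i * (lam.count i).factorial

/-- The cycle type of a permutation of `Fin n`, as the multiset of parts of a partition of `n`
(including the parts equal to `1` corresponding to fixed points). -/
def cycM {n : ℕ} (g : Equiv.Perm (Fin n)) : Multiset ℕ :=
  g.cycleType + Multiset.replicate (n - g.support.card) 1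

/-- The value of the irreducible character `s_λ` of the symmetric group on the conjugacy class
of cycle type `nu`, given by the Jacobi–Trudi determinant `s_λ = det(h_{λ_i - i + j})_{i,j}`,
where `h_α` has value `Mcount α ν` on the class of cycle type `ν`. -/
def sval (lam nu : Multiset ℕ) : ℚ :=
  let L := (lam.sort (· ≤ ·)).reverse
  let l := Multiset.card lam
  ∑ σ : Equiv.Perm (Fin l),
    ((Equiv.Perm.sign σ : ℤ) : ℚ) *
      (if ∀ i : Fin l, (i : ℕ) ≤ L.getD i 0 + (σ i : ℕ) then
        (Mcount ((Multiset.map (fun i : Fin l => L.getD i 0 + (σ i : ℕ) - (i : ℕ))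
            (Finset.univ.val : Multiset (Fin l))).filter (fun x => x ≠ 0)) nu : ℚ)
       else 0)

/-- The irreducible character of `S_n` labelled by the partition `lam`, as a class function on
the symmetric group `S_n = Perm (Fin n)`. -/
def sFun {n : ℕ} (lam : Nat.Partition n) : Equiv.Perm (Fin n) → ℚ :=
  fun g => sval lam.parts (cycM g)

/-- The usual scalar product of class functions on a finite group:
`⟨f, h⟩ = |G|⁻¹ ∑_{g ∈ G} f(g) h(g⁻¹)`. -/
def sp {G : Type*} [Group G] [Fintype G] (f h : G → ℚ) : ℚ :=
  (Fintype.card G : ℚ)⁻¹ * ∑ g : G, f g * h g⁻¹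

/-- The class function `p_λ` on `S_w`: `p_λ(g_μ) = z_λ δ_{λμ}`. -/
def pFun {w : ℕ} (lam : Nat.Partition w) : Equiv.Perm (Fin w) → ℚ :=
  fun g => if cycM g = lam.parts then (zMult lam.parts : ℚ) else 0

/-- The class function `p̃_λ = z_λ⁻¹ p_λ` on `S_w`: the indicator of the class of type `λ`. -/
def ptFun {w : ℕ} (lam : Nat.Partition w) : Equiv.Perm (Fin w) → ℚ :=
  fun g => if cycM g = lam.parts then 1 else 0

/-- The induced class function along an injection `ι : H → G` (underlying a subgroup inclusion):
`Ind φ (g) = |H|⁻¹ ∑_{x ∈ G} ∑_{h ∈ H, ι(h) = x g x⁻¹} φ(h)`. -/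
def IndFun {H G : Type*} [Fintype H] [Fintype G] [Group G] (ι : H → G) (φ : H → ℚ) :
    G → ℚ :=
  fun g => (Fintype.card H : ℚ)⁻¹ * ∑ x : G, ∑ h : H, if ι h = x * g * x⁻¹ then φ h else 0

/-- A bijection `Σ_i Fin (w_i) ≃ Fin w` when `∑_i w_i = w`, realising `Fin w` as the disjoint
union of blocks of sizes `w_i`. -/
def embSigma {η : Type*} [Fintype η] (ws : η → ℕ) {w : ℕ} (h : ∑ i, ws i = w) :
    (Σ i, Fin (ws i)) ≃ Fin w :=
  Fintype.equivOfCardEq (by simp [h])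

/-- The type of all partitions (of arbitrary natural numbers). -/
abbrev PttAll : Type := Σ n : ℕ, Nat.Partition n

/-- Partitions of size at most `w`, with bounded first component (a finite type). -/
abbrev PBP (w : ℕ) : Type := (m : Fin (w + 1)) × Nat.Partition m

/-- `PMap_w(T)`: the (finite) set of maps from `T` to partitions, of total size `w`. -/
abbrev PMapw (T : Type*) [Fintype T] (w : ℕ) : Type _ :=
  {lam : T → PBP w // ∑ t, ((lam t).1 : ℕ) = w}

/-- The scalar product on `Λ_ℚ = ⊕_w CF(S_w)` of two graded elements (the graded components
being orthogonal, this is zero when the degrees differ). -/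
def pairCF {a b : ℕ} (f : Equiv.Perm (Fin a) → ℚ) (g : Equiv.Perm (Fin b) → ℚ) : ℚ :=
  if h : a = b then sp f (fun σ => g ((finCongr h).permCongr σ)) else 0

/-- The product in `Λ_ℚ` of a finite family of graded class functions: the class function on
`S_w` induced from the outer tensor product on the Young subgroup `∏_i S_{w_i}`. -/
def multiProdCF {η : Type*} [Fintype η] (ws : η → ℕ) {w : ℕ} (h : ∑ i, ws i = w)
    (fs : ∀ i, Equiv.Perm (Fin (ws i)) → ℚ) : Equiv.Perm (Fin w) → ℚ :=
  IndFun (fun (g : ∀ i, Equiv.Perm (Fin (ws i))) =>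
      ((embSigma ws h).symm.trans
        ((Equiv.sigmaCongrRight (fun i => (g i : Fin (ws i) ≃ Fin (ws i)))).trans
          (embSigma ws h)) : Equiv.Perm (Fin w)))
    (fun g => ∏ i, fs i (g i))

/-- The `(λ̲, μ̲)`-entry of the matrix `A^{≀}(u, v)`:
`∑_{ν̲} (∏_t ⟨u_{λ̲(t)}, ∏_q p̃_{ν̲(t,q)}⟩) (∏_q ⟨v_{μ̲(q)}, ∏_t p_{ν̲(t,q)}⟩)
  (∏_{t,q} A_{tq}^{l(ν̲(t,q))})`,
the sum running over all maps `ν̲` from `T × Q` to partitions. -/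
def wrGen {T Q : Type*} [Fintype T] [Fintype Q]
    (u v : ∀ n : ℕ, Nat.Partition n → Equiv.Perm (Fin n) → ℚ)
    (A : T → Q → ℚ) (lam : T → PttAll) (mu : Q → PttAll) : ℚ :=
  ∑ᶠ nu : T × Q → PttAll,
    (∏ t : T, pairCF (u (lam t).1 (lam t).2)
        (multiProdCF (fun q => (nu (t, q)).1) rfl (fun q => ptFun (nu (t, q)).2))) *
    (∏ q : Q, pairCF (v (mu q).1 (mu q).2)
        (multiProdCF (fun t => (nu (t, q)).1) rfl (fun t => pFun (nu (t, q)).2))) *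
    (∏ t : T, ∏ q : Q, A t q ^ (Multiset.card (nu (t, q)).2.parts))

/-- The `(λ̲, μ̲)`-entry of the matrix `A^{≀}(s, s)`. -/
def wrS {T Q : Type*} [Fintype T] [Fintype Q] (A : T → Q → ℚ)
    (lam : T → PttAll) (mu : Q → PttAll) : ℚ :=
  wrGen (fun _ lam' => sFun lam') (fun _ lam' => sFun lam') A lam mu

/-- The matrix `A^{≀w}(s, s)`, the `PMap_w(T) × PMap_w(Q)`-submatrix of `A^{≀}(s, s)`. -/
def wrSMat {T Q : Type*} [Fintype T] [Fintype Q] (A : T → Q → ℚ) (w : ℕ) :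
    Matrix (PMapw T w) (PMapw Q w) ℚ :=
  Matrix.of fun lam mu =>
    wrS A (fun t => ⟨(lam.1 t).1, (lam.1 t).2⟩) (fun q => ⟨(mu.1 q).1, (mu.1 q).2⟩)

/-- The permutation characters of a group `G`, as a submonoid of the functions on `G`. -/
def permChars (G : Type*) [Group G] : Submonoid (G → ℚ) where
  carrier := {f | ∃ (Ω : Type) (_ : Fintype Ω) (ρ : G →* Equiv.Perm Ω),
    ∀ g, f g = (Nat.card {x // ρ g x = x} : ℚ)}
  one_mem' := ⟨Unit, inferInstance, 1, fun g => by simp⟩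
  mul_mem' := by
    rintro f f' ⟨Ω, _, ρ, h⟩ ⟨Ω', _, ρ', h'⟩
    refine ⟨Ω × Ω', inferInstance,
      { toFun := fun g => Equiv.prodCongr (ρ g) (ρ' g)
        map_one' := by ext x <;> simp
        map_mul' := fun a b => by ext x <;> simp }, fun g => ?_⟩
    rw [Pi.mul_apply, h, h', ← Nat.cast_mul, ← Nat.card_prod]
    congr 1
    refine Nat.card_congr
      { toFun := fun x => ⟨(x.1.1, x.2.1), by
          have h1 := x.1.2
          have h2 := x.2.2
          simp [h1, h2]⟩
        invFun := fun x => (⟨x.1.1, (Prod.ext_iff.1 x.2).1⟩, ⟨x.1.2, (Prod.ext_iff.1 x.2).2⟩)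
        left_inv := fun x => rfl
        right_inv := fun x => rfl }

/-- The ring of `ℤ`-combinations of permutation characters. -/
def VC (G : Type*) [Group G] : Subring (G → ℚ) := Subring.closure (permChars G : Set (G → ℚ))

lemma permChars_avg {G : Type*} [Group G] [Fintype G] (f : G → ℚ) (hf : f ∈ permChars G) :
    ∃ k : ℤ, (Fintype.card G : ℚ)⁻¹ * ∑ g, f g = k := by
  obtain ⟨Ω, _, ρ, h⟩ := hf
  let _ : MulAction G Ω := MulAction.compHom Ω ρ
  have key := MulAction.sum_card_fixedBy_eq_card_orbits_mul_card_group G Ω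
  refine ⟨(Fintype.card (Quotient (MulAction.orbitRel G Ω)) : ℕ), ?_⟩
  have h0 : (Fintype.card G : ℚ) ≠ 0 := by simp
  rw [inv_mul_eq_iff_eq_mul₀ h0]
  have : ∑ g, f g = ((∑ g : G, Fintype.card (MulAction.fixedBy Ω g) : ℕ) : ℚ) := by
    push_cast
    refine Finset.sum_congr rfl fun g _ => ?_
    rw [h]
    congr 1
    rw [← Nat.card_eq_fintype_card]
    exact Nat.card_congr (Equiv.refl _)
  rw [this, key]
  push_cast
  ring

lemma VC_avg {G : Type*} [Group G] [Fintype G] (f : G → ℚ) (hf : f ∈ VC G) :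
    ∃ k : ℤ, (Fintype.card G : ℚ)⁻¹ * ∑ g, f g = k := by
  unfold VC at hf
  rw [Subring.mem_closure_iff, Submonoid.closure_eq] at hf
  induction hf using AddSubgroup.closure_induction with
  | mem x hx => exact permChars_avg x hx
  | zero => exact ⟨0, by simp⟩
  | add x y _ _ hx hy =>
    obtain ⟨a, ha⟩ := hx
    obtain ⟨b, hb⟩ := hy
    exact ⟨a + b, by simp [Finset.sum_add_distrib, mul_add, ha, hb]⟩
  | neg x _ hx =>
    obtain ⟨a, ha⟩ := hx
    exact ⟨-a, by simp [ha]⟩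

lemma VC_comp {G G' : Type*} [Group G] [Group G'] (φ : G →* G') (f : G' → ℚ) (hf : f ∈ VC G') :
    (fun g => f (φ g)) ∈ VC G := by
  unfold VC at hf
  induction hf using Subring.closure_induction with
  | mem x hx =>
    obtain ⟨Ω, i, ρ, h⟩ := hx
    exact Subring.subset_closure ⟨Ω, i, ρ.comp φ, fun g => h _⟩
  | zero => exact (VC G).zero_mem
  | one => exact (VC G).one_mem
  | add x y _ _ hx hy => exact (VC G).add_mem hx hy
  | neg x _ hx => exact (VC G).neg_mem hx
  | mul x y _ _ hx hy => exact (VC G).mul_mem hx hy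

lemma exists_equiv_of_map_eq {A B : Type*} [Fintype A] [Fintype B] (s : A → ℕ) (r : B → ℕ)
    (h : (Finset.univ.val : Multiset A).map s = (Finset.univ.val : Multiset B).map r) :
    ∃ e : A ≃ B, ∀ a, s a = r (e a) := by
  have hc : ∀ k, Nonempty ({a // s a = k} ≃ {b // r b = k}) := fun k => by
    refine ⟨Fintype.equivOfCardEq ?_⟩
    have := congrArg (Multiset.count k) h
    rw [Multiset.count_map, Multiset.count_map] at this
    rw [Fintype.card_subtype, Fintype.card_subtype]
    simp only [Finset.card, Finset.filter_val]
    simpa only [eq_comm] using this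
  refine ⟨(Equiv.sigmaFiberEquiv s).symm.trans ((Equiv.sigmaCongrRight fun k => (hc k).some).trans
    (Equiv.sigmaFiberEquiv r)), fun a => ?_⟩
  exact (((hc (s a)).some) ⟨a, rfl⟩).2.symm

/-- The size of an orbit. -/
def orbSize {X : Type*} [Fintype X] (g : Equiv.Perm X)
    (c : Quotient (Equiv.Perm.SameCycle.setoid g)) : ℕ :=
  Fintype.card {x : X // Quotient.mk (Equiv.Perm.SameCycle.setoid g) x = c}

lemma orb_eq_cycM {n : ℕ} (g : Equiv.Perm (Fin n)) :
    (Finset.univ.val : Multiset (Quotient (Equiv.Perm.SameCycle.setoid g))).map (orbSize g)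
      = cycM g := by
  set Q := Quotient (Equiv.Perm.SameCycle.setoid g)
  let F : Q → Equiv.Perm (Fin n) :=
    Quotient.lift (fun x => g.cycleOf x) (fun a b h => Equiv.Perm.SameCycle.cycleOf_eq h)
  have hF : ∀ x, F (Quotient.mk _ x) = g.cycleOf x := fun x => rfl
  have h1 : ((Finset.univ.val : Multiset Q).filter (fun c => F c ≠ 1)).map (orbSize g)
      = g.cycleType := by
    rw [Equiv.Perm.cycleType_def]
    refine Multiset.map_eq_map_of_bij_of_nodup _ _ ?_ ?_ (fun c _ => F c) ?_ ?_ ?_ ?_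
    · exact Multiset.Nodup.filter _ Finset.univ.nodup
    · exact Finset.nodup _
    · intro c hc
      induction c using Quotient.inductionOn with | _ x =>
      rw [Multiset.mem_filter, hF] at hc
      exact Equiv.Perm.cycleOf_ne_one_iff_mem_cycleFactorsFinset.1 hc.2
    · intro c hc d hd hcd
      induction c using Quotient.inductionOn with | _ x =>
      induction d using Quotient.inductionOn with | _ y =>
      rw [Multiset.mem_filter, hF, ne_eq, Equiv.Perm.cycleOf_eq_one_iff] at hc hd
      rw [hF, hF] at hcd
      exact Quotient.sound ((Equiv.Perm.sameCycle_iff_cycleOf_eq_of_mem_support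
        (by simpa using hc.2) (by simpa using hd.2)).2 hcd)
    · intro c hc
      have hc' : c ∈ g.cycleFactorsFinset := hc
      have hcy := (Equiv.Perm.mem_cycleFactorsFinset_iff.1 hc').1
      obtain ⟨a, ha⟩ := hcy.nonempty_support
      have := Equiv.Perm.cycle_is_cycleOf ha hc'
      refine ⟨Quotient.mk _ a, ?_, ?_⟩
      · rw [Multiset.mem_filter, hF, ← this]
        exact ⟨by simp, hcy.ne_one⟩
      · rw [hF, ← this]
    · intro c hc
      induction c using Quotient.inductionOn with | _ x =>
      rw [Multiset.mem_filter, hF, ne_eq, Equiv.Perm.cycleOf_eq_one_iff] at hc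
      rw [hF, Function.comp_apply, ← Fintype.card_coe]
      refine Fintype.card_congr (Equiv.subtypeEquivRight fun y => ?_)
      rw [Equiv.Perm.mem_support_cycleOf_iff' hc.2, eq_comm]
      exact Quotient.eq
  have h2 : ((Finset.univ.val : Multiset Q).filter (fun c => ¬ F c ≠ 1)).map (orbSize g)
      = Multiset.replicate (Multiset.card
        ((Finset.univ.val : Multiset Q).filter (fun c => ¬ F c ≠ 1))) 1 := by
    rw [Multiset.eq_replicate]
    refine ⟨by simp, fun b hb => ?_⟩
    obtain ⟨c, hc, rfl⟩ := Multiset.mem_map.1 hb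
    induction c using Quotient.inductionOn with | _ x =>
    rw [Multiset.mem_filter, hF, not_not, Equiv.Perm.cycleOf_eq_one_iff] at hc
    rw [orbSize, Fintype.card_eq_one_iff]
    refine ⟨⟨x, rfl⟩, fun y => Subtype.ext ?_⟩
    have : g.SameCycle x y.1 := (Quotient.exact y.2).symm
    obtain ⟨k, hk⟩ := this
    rw [← hk]
    exact Equiv.Perm.zpow_apply_eq_self_of_apply_eq_self hc.2 k
  have hsum : ((Finset.univ.val : Multiset Q).map (orbSize g)).sum = n := by
    have : Fintype.card (Σ c : Q, {x : Fin n // Quotient.mk (Equiv.Perm.SameCycle.setoid g) x = c})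
        = n := by
      rw [Fintype.card_congr (Equiv.sigmaFiberEquiv _), Fintype.card_fin]
    rw [Fintype.card_sigma] at this
    exact this
  rw [← Multiset.filter_add_not (fun c => F c ≠ 1) (Finset.univ.val : Multiset Q),
    Multiset.map_add, h1, h2] at hsum ⊢
  rw [Multiset.sum_add, Equiv.Perm.sum_cycleType, Multiset.sum_replicate, smul_eq_mul,
    mul_one] at hsum
  rw [cycM]
  congr 2
  omega

/-- Maps invariant under a permutation are maps on the set of orbits. -/
def invEquiv {X : Type*} [Finite X] (I : Type*) (g : Equiv.Perm X) :
    {f : X → I // ∀ x, f (g x) = f x} ≃ (Quotient (Equiv.Perm.SameCycle.setoid g) → I) where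
  toFun f := Quotient.lift f.1 (fun a b h => by
    obtain ⟨i, hi⟩ := Equiv.Perm.SameCycle.exists_nat_pow_eq h
    rw [← hi]
    clear hi
    induction i with
    | zero => simp
    | succ i ih => rw [pow_succ', Equiv.Perm.mul_apply, f.2]; exact ih)
  invFun h := ⟨fun x => h (Quotient.mk _ x), fun x => congrArg h (Quotient.sound (by
    exact Equiv.Perm.sameCycle_apply_left.2 (Equiv.Perm.SameCycle.refl g x)))⟩
  left_inv f := rfl
  right_inv h := by
    funext c
    induction c using Quotient.inductionOn with | _ x => rfl

lemma invMaps_mem {X I : Type} [Fintype X] [Fintype I] (P : (X → I) → Prop)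
    (hP : ∀ (g : Equiv.Perm X) f, P f → P (fun x => f (g x))) :
    (fun g : Equiv.Perm X => (Nat.card {f : X → I // P f ∧ ∀ x, f (g x) = f x} : ℚ))
      ∈ VC (Equiv.Perm X) := by
  refine Subring.subset_closure ⟨{f : X → I // P f}, inferInstance,
    { toFun := fun g =>
        { toFun := fun f => ⟨fun x => f.1 (g⁻¹ x), hP _ _ f.2⟩
          invFun := fun f => ⟨fun x => f.1 (g x), hP _ _ f.2⟩
          left_inv := fun f => by ext; simp
          right_inv := fun f => by ext; simp }
      map_one' := by ext; simp
      map_mul' := fun a b => by ext; simp }, fun g => ?_⟩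
  refine congrArg (Nat.cast : ℕ → ℚ) ?_
  refine Nat.card_congr ((Equiv.subtypeSubtypeEquivSubtypeInter _ _).symm.trans
    (Equiv.subtypeEquivRight fun f => ?_))
  constructor
  · intro h
    refine Subtype.ext (funext fun x => ?_)
    have := h (g⁻¹ x)
    simpa using this.symm
  · intro h x
    have := congrFun (congrArg Subtype.val h) (g x)
    simpa using this.symm

lemma card_cycM {n : ℕ} (g : Equiv.Perm (Fin n)) :
    Multiset.card (cycM g) = Fintype.card (Quotient (Equiv.Perm.SameCycle.setoid g)) := by
  rw [← orb_eq_cycM, Multiset.card_map]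
  rfl

lemma natPow_mem (n a : ℕ) :
    (fun g : Equiv.Perm (Fin n) => (a : ℚ) ^ Multiset.card (cycM g))
      ∈ VC (Equiv.Perm (Fin n)) := by
  convert invMaps_mem (X := Fin n) (I := Fin a) (fun _ => True) (fun _ _ _ => trivial) using 2 with g
  rw [card_cycM]
  have := Nat.card_congr ((Equiv.subtypeEquivRight (p := fun f : Fin n → Fin a =>
    True ∧ ∀ x, f (g x) = f x) fun f => by simp).trans (invEquiv (Fin a) g))
  rw [this]
  simp

lemma sign_mem (n : ℕ) :
    (fun g : Equiv.Perm (Fin n) => ((Equiv.Perm.sign g : ℤ) : ℚ)) ∈ VC (Equiv.Perm (Fin n)) := by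
  have h : (fun g : Equiv.Perm (Fin n) =>
      (Nat.card {x : ℤˣ // MulAction.toPermHom ℤˣ ℤˣ (Equiv.Perm.sign g) x = x} : ℚ))
      ∈ VC (Equiv.Perm (Fin n)) :=
    Subring.subset_closure ⟨ℤˣ, inferInstance,
      (MulAction.toPermHom ℤˣ ℤˣ).comp Equiv.Perm.sign, fun g => rfl⟩
  have h2 := (VC (Equiv.Perm (Fin n))).sub_mem h (VC (Equiv.Perm (Fin n))).one_mem
  convert h2 using 1
  funext g
  rcases Int.units_eq_one_or (Equiv.Perm.sign g) with hs | hs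
  · simp [hs]
    norm_num
  · simp [hs]

lemma neg_one_pow_cycM {n : ℕ} (g : Equiv.Perm (Fin n)) :
    (-1 : ℚ) ^ Multiset.card (cycM g) = (-1) ^ n * ((Equiv.Perm.sign g : ℤ) : ℚ) := by
  have hle : g.support.card ≤ n := by simpa using Finset.card_le_univ g.support
  rw [Equiv.Perm.sign_of_cycleType, cycM, Equiv.Perm.sum_cycleType]
  simp only [Multiset.card_add, Multiset.card_replicate]
  push_cast
  rw [← pow_add]
  obtain ⟨k, hk⟩ := Nat.exists_eq_add_of_le hle
  have : n - g.support.card = k := by omega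
  rw [this]
  have : n + (g.support.card + Multiset.card g.cycleType)
    = 2 * g.support.card + (Multiset.card g.cycleType + k) := by omega
  rw [this, pow_add (-1 : ℚ) (2 * _), pow_mul]
  simp

lemma intPow_mem (n : ℕ) (a : ℤ) :
    (fun g : Equiv.Perm (Fin n) => (a : ℚ) ^ Multiset.card (cycM g))
      ∈ VC (Equiv.Perm (Fin n)) := by
  rcases Int.eq_nat_or_neg a with ⟨m, rfl | rfl⟩
  · simpa using natPow_mem n m
  · have h : (fun g : Equiv.Perm (Fin n) => (((-(m : ℤ)) : ℤ) : ℚ) ^ Multiset.card (cycM g))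
        = (-1) ^ n * ((fun g : Equiv.Perm (Fin n) => ((Equiv.Perm.sign g : ℤ) : ℚ)) *
          (fun g : Equiv.Perm (Fin n) => (m : ℚ) ^ Multiset.card (cycM g))) := by
      funext g
      have : (((-(m : ℤ)) : ℤ) : ℚ) = (-1) * (m : ℚ) := by simp
      rw [this, mul_pow, neg_one_pow_cycM]
      simp [mul_assoc]
    rw [h]
    exact mul_mem (pow_mem (neg_mem (one_mem _)) _) (mul_mem (sign_mem n) (natPow_mem n m))

lemma Mcount_eq {n : ℕ} (lam : Multiset ℕ) (g : Equiv.Perm (Fin n)) :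
    Mcount lam (cycM g) = Nat.card {f : Fin n → Fin (Multiset.card lam) //
      (∀ i, Nat.card {x // f x = i} = (lam.sort (· ≤ ·)).getD i 0) ∧ ∀ x, f (g x) = f x} := by
  set mu := cycM g with hmu
  have hmap : (Finset.univ.val : Multiset (Fin (Multiset.card mu))).map
      (fun j : Fin (Multiset.card mu) => (mu.sort (· ≤ ·)).getD (j : ℕ) 0) = mu := by
    have hl : (mu.sort (· ≤ ·)).length = Multiset.card mu := by simp
    conv_rhs => rw [← Multiset.sort_eq mu (· ≤ ·)]
    have : (List.finRange (Multiset.card mu)).map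
        (fun j : Fin (Multiset.card mu) => (mu.sort (· ≤ ·)).getD (j : ℕ) 0)
        = mu.sort (· ≤ ·) := by
      apply List.ext_getElem
      · simp
      · intro i h1 h2
        simp
    exact congrArg (fun l : List ℕ => (l : Multiset ℕ)) this
  obtain ⟨e, he⟩ := exists_equiv_of_map_eq _ _ (hmap.trans (hmu.trans (orb_eq_cycM g).symm))
  rw [Mcount, ← Nat.card_eq_fintype_card]
  refine Nat.card_congr ?_
  have step : {f : Fin n → Fin (Multiset.card lam) //
      (∀ i, Nat.card {x // f x = i} = (lam.sort (· ≤ ·)).getD i 0) ∧ ∀ x, f (g x) = f x} ≃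
      {f : {f : Fin n → Fin (Multiset.card lam) // ∀ x, f (g x) = f x} //
        ∀ i, Nat.card {x // f.1 x = i} = (lam.sort (· ≤ ·)).getD i 0} :=
    (Equiv.subtypeEquivRight fun f => and_comm).trans
      (Equiv.subtypeSubtypeEquivSubtypeInter _ _).symm
  refine Equiv.trans ?_ step.symm
  refine Equiv.subtypeEquiv ((Equiv.arrowCongr e (Equiv.refl _)).trans
    (invEquiv (Fin (Multiset.card lam)) g).symm) fun f => ?_
  refine forall_congr' fun i => ?_
  suffices h : (∑ j ∈ Finset.univ.filter (fun j => f j = i), (mu.sort (· ≤ ·)).getD (j : ℕ) 0)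
      = Nat.card {x // (((Equiv.arrowCongr e (Equiv.refl _)).trans
    (invEquiv (Fin (Multiset.card lam)) g).symm) f).1 x = i} by
    rw [h]
  have h1 : ∀ x, (((Equiv.arrowCongr e (Equiv.refl _)).trans
    (invEquiv (Fin (Multiset.card lam)) g).symm) f).1 x = f (e.symm (Quotient.mk _ x)) :=
    fun x => rfl
  simp only [h1]
  rw [Nat.card_eq_fintype_card, Finset.sum_filter]
  simp only [he]
  have h2 := Equiv.sum_comp e (fun c => if f (e.symm c) = i then orbSize g c else 0)
  simp only [Equiv.symm_apply_apply] at h2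
  rw [h2, ← Finset.sum_filter]
  simp only [orbSize]
  rw [Finset.sum_subtype (p := fun c => f (e.symm c) = i) _ (by simp), ← Fintype.card_sigma]
  refine Fintype.card_congr
    { toFun := fun y => ⟨y.2.1, by rw [y.2.2]; exact y.1.2⟩
      invFun := fun x => ⟨⟨Quotient.mk _ x.1, x.2⟩, ⟨x.1, rfl⟩⟩
      left_inv := ?_
      right_inv := fun x => rfl }
  rintro ⟨⟨c, hc⟩, ⟨x, hx⟩⟩
  have hx' : Quotient.mk _ x = c := hx
  subst hx'
  rfl

lemma Mcount_mem (n : ℕ) (lam : Multiset ℕ) :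
    (fun g : Equiv.Perm (Fin n) => (Mcount lam (cycM g) : ℚ)) ∈ VC (Equiv.Perm (Fin n)) := by
  simp only [Mcount_eq]
  refine invMaps_mem (fun f : Fin n → Fin (Multiset.card lam) =>
    ∀ i : Fin (Multiset.card lam),
      Nat.card {x // f x = i} = (lam.sort (· ≤ ·)).getD i 0) ?_
  intro g f hf i
  rw [← hf i]
  exact Nat.card_congr (Equiv.subtypeEquiv g fun x => Iff.rfl)

lemma sval_mem (n : ℕ) (lam : Multiset ℕ) :
    (fun g : Equiv.Perm (Fin n) => sval lam (cycM g)) ∈ VC (Equiv.Perm (Fin n)) := by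
  simp only [sval]
  have key := fun σ : Equiv.Perm (Fin (Multiset.card lam)) =>
    (VC (Equiv.Perm (Fin n))).zsmul_mem (n := (Equiv.Perm.sign σ : ℤ))
      (x := fun g => if ∀ i : Fin (Multiset.card lam),
        (i : ℕ) ≤ (lam.sort (· ≤ ·)).reverse.getD i 0 + (σ i : ℕ) then
        (Mcount ((Multiset.map (fun i : Fin (Multiset.card lam) =>
          (lam.sort (· ≤ ·)).reverse.getD i 0 + (σ i : ℕ) - (i : ℕ))
            (Finset.univ.val : Multiset (Fin (Multiset.card lam)))).filter (fun x => x ≠ 0))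
              (cycM g) : ℚ)
       else 0) (by
        split_ifs
        · exact Mcount_mem n _
        · exact zero_mem _)
  have := (VC (Equiv.Perm (Fin n))).sum_mem (t := Finset.univ) (fun σ _ => key σ)
  convert this using 1
  funext g
  simp

lemma cycM_conj {n : ℕ} (x g : Equiv.Perm (Fin n)) : cycM (x * g * x⁻¹) = cycM g := by
  simp [cycM, Equiv.Perm.cycleType_conj]

lemma cycM_inv {n : ℕ} (g : Equiv.Perm (Fin n)) : cycM g⁻¹ = cycM g := by
  simp [cycM]

lemma filter_cycM {n : ℕ} (g : Equiv.Perm (Fin n)) :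
    (cycM g).filter (fun k => 2 ≤ k) = g.cycleType := by
  rw [cycM, Multiset.filter_add,
    Multiset.filter_eq_self.2 fun _ => Equiv.Perm.two_le_of_mem_cycleType]
  simp [Multiset.filter_eq_nil, Multiset.mem_replicate]

lemma isConj_of_cycM {n : ℕ} {g g' : Equiv.Perm (Fin n)} (h : cycM g = cycM g') :
    IsConj g g' := by
  rw [Equiv.Perm.isConj_iff_cycleType_eq, ← filter_cycM, ← filter_cycM, h]

lemma sum_cycM {n : ℕ} (g : Equiv.Perm (Fin n)) : (cycM g).sum = n := by
  have hle : g.support.card ≤ n := by simpa using Finset.card_le_univ g.support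
  simp [cycM, Equiv.Perm.sum_cycleType]
  omega

/-- The cycle type as a partition. -/
def cycPart {n : ℕ} (g : Equiv.Perm (Fin n)) : Nat.Partition n where
  parts := cycM g
  parts_pos := by
    intro i hi
    rw [cycM, Multiset.mem_add] at hi
    rcases hi with hi | hi
    · exact lt_of_lt_of_le two_pos (Equiv.Perm.two_le_of_mem_cycleType hi)
    · rw [Multiset.eq_of_mem_replicate hi]; exact one_pos
  parts_sum := sum_cycM g

lemma zMult_add (m : Multiset ℕ) (hm : ∀ i ∈ m, 2 ≤ i) (k : ℕ) :
    zMult (m + Multiset.replicate k 1) =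
      k.factorial * m.prod * ∏ i ∈ m.toFinset, (m.count i).factorial := by
  have h1 : (1 : ℕ) ∉ m.toFinset := fun h => by
    have := hm 1 (Multiset.mem_toFinset.1 h)
    omega
  have h1' : (1 : ℕ) ∉ m := fun h => h1 (Multiset.mem_toFinset.2 h)
  have hS : zMult (m + Multiset.replicate k 1) = ∏ i ∈ insert 1 m.toFinset,
      i ^ (m + Multiset.replicate k 1).count i *
        ((m + Multiset.replicate k 1).count i).factorial := by
    refine Finset.prod_subset ?_ ?_
    · intro i hi
      rw [Multiset.mem_toFinset, Multiset.mem_add] at hi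
      rcases hi with hi | hi
      · exact Finset.mem_insert_of_mem (Multiset.mem_toFinset.2 hi)
      · rw [Multiset.eq_of_mem_replicate hi]; exact Finset.mem_insert_self _ _
    · intro i _ hi
      rw [Multiset.mem_toFinset] at hi
      rw [Multiset.count_eq_zero_of_notMem hi]
      simp
  rw [hS, Finset.prod_insert h1, Finset.prod_multiset_count,
    mul_assoc k.factorial, ← Finset.prod_mul_distrib]
  congr 1
  · simp [Multiset.count_eq_zero_of_notMem h1']
  · refine Finset.prod_congr rfl fun i hi => ?_
    have : i ≠ 1 := fun h => h1 (h ▸ hi)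
    have h0 : (Multiset.replicate k 1).count i = 0 := by
      rw [Multiset.count_replicate, if_neg (Ne.symm this)]
    rw [Multiset.count_add, h0, add_zero]

lemma parts_split {w : ℕ} (nu : Nat.Partition w) :
    nu.parts = nu.parts.filter (fun k => 2 ≤ k) +
      Multiset.replicate (w - (nu.parts.filter (fun k => 2 ≤ k)).sum) 1 := by
  have h := Multiset.filter_add_not (fun k => 2 ≤ k) nu.parts
  have h2 : nu.parts.filter (fun k => ¬ 2 ≤ k) =
      Multiset.replicate (Multiset.card (nu.parts.filter (fun k => ¬ 2 ≤ k))) 1 := by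
    rw [Multiset.eq_replicate]
    refine ⟨rfl, fun b hb => ?_⟩
    rw [Multiset.mem_filter] at hb
    have := nu.parts_pos hb.1
    omega
  have h3 := congrArg Multiset.sum h
  rw [Multiset.sum_add, h2, nu.parts_sum, Multiset.sum_replicate, smul_eq_mul, mul_one] at h3
  conv_lhs => rw [← h, h2]
  congr 2
  omega

lemma cycM_eq_iff {w : ℕ} (nu : Nat.Partition w) (g : Equiv.Perm (Fin w)) :
    cycM g = nu.parts ↔ g.cycleType = nu.parts.filter (fun k => 2 ≤ k) := by
  constructor
  · intro h
    rw [← h, filter_cycM]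
  · intro h
    rw [parts_split nu, cycM, ← h, Equiv.Perm.sum_cycleType]

lemma sum_filter_le {w : ℕ} (nu : Nat.Partition w) :
    (nu.parts.filter (fun k => 2 ≤ k)).sum ≤ w := by
  have h3 := congrArg Multiset.sum (Multiset.filter_add_not (fun k => 2 ≤ k) nu.parts)
  rw [Multiset.sum_add, nu.parts_sum] at h3
  omega

lemma exists_cycM {w : ℕ} (nu : Nat.Partition w) : ∃ g : Equiv.Perm (Fin w), cycM g = nu.parts := by
  simp only [cycM_eq_iff]
  rw [Equiv.Perm.exists_with_cycleType_iff]
  refine ⟨?_, fun a ha => (Multiset.mem_filter.1 ha).2⟩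
  rw [Fintype.card_fin]
  exact sum_filter_le nu

lemma card_mul_zMult {w : ℕ} (nu : Nat.Partition w) :
    (Finset.univ.filter (fun g : Equiv.Perm (Fin w) => cycM g = nu.parts)).card *
      zMult nu.parts = w.factorial := by
  have h := Equiv.Perm.card_of_cycleType_mul_eq (Fin w) (nu.parts.filter (fun k => 2 ≤ k))
  rw [if_pos ⟨by rw [Fintype.card_fin]; exact sum_filter_le nu,
    fun a ha => (Multiset.mem_filter.1 ha).2⟩, Fintype.card_fin] at h
  rw [← h]
  congr 1
  · congr 1
    ext g
    simp only [Finset.mem_filter, Finset.mem_univ, true_and, cycM_eq_iff]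
  · conv_lhs => rw [parts_split nu]
    rw [zMult_add _ (fun a ha => (Multiset.mem_filter.1 ha).2)]

/-- The inclusion of a Young subgroup. -/
def youngHom {η : Type*} [Fintype η] (ws : η → ℕ) :
    (∀ i, Equiv.Perm (Fin (ws i))) →* Equiv.Perm (Fin (∑ i, ws i)) where
  toFun g := ((embSigma ws rfl).symm.trans
        ((Equiv.sigmaCongrRight (fun i => (g i : Fin (ws i) ≃ Fin (ws i)))).trans
          (embSigma ws rfl)) : Equiv.Perm (Fin (∑ i, ws i)))
  map_one' := by
    ext x
    simp [Equiv.sigmaCongrRight]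
  map_mul' a b := by
    ext x
    simp [Equiv.sigmaCongrRight]

lemma sp_IndFun {G H : Type*} [Group G] [Fintype G] [Fintype H] (ι : H → G) (f : G → ℚ)
    (φ : H → ℚ) (h1 : ∀ x g, f (x * g * x⁻¹) = f g) (h2 : ∀ g, f g⁻¹ = f g) :
    sp f (IndFun ι φ) = (Fintype.card H : ℚ)⁻¹ * ∑ h, f (ι h) * φ h := by
  have h0 : (Fintype.card G : ℚ) ≠ 0 := by simp
  have e1 : ∑ g : G, f g * IndFun ι φ g⁻¹ = ∑ g : G, f g * IndFun ι φ g := by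
    rw [← Equiv.sum_comp (Equiv.inv G)]
    simp [h2]
  rw [sp, e1]
  simp only [IndFun]
  have e2 : ∀ x : G, ∑ g : G, ∑ h : H, f g * (if ι h = x * g * x⁻¹ then φ h else 0)
      = ∑ h, f (ι h) * φ h := by
    intro x
    rw [Finset.sum_comm]
    refine Finset.sum_congr rfl fun h _ => ?_
    rw [Finset.sum_eq_single (x⁻¹ * ι h * x)]
    · rw [if_pos (by group)]
      congr 1
      have := h1 x⁻¹ (ι h)
      rwa [inv_inv] at this
    · intro g _ hg
      rw [if_neg, mul_zero]
      intro hh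
      apply hg
      rw [hh]
      group
    · simp
  have e3 : ∑ g : G, f g * ((Fintype.card H : ℚ)⁻¹ *
      ∑ x : G, ∑ h : H, if ι h = x * g * x⁻¹ then φ h else 0)
      = (Fintype.card H : ℚ)⁻¹ *
        ∑ x : G, ∑ g : G, ∑ h : H, f g * (if ι h = x * g * x⁻¹ then φ h else 0) := by
    rw [Finset.sum_comm, Finset.mul_sum]
    refine Finset.sum_congr rfl fun g _ => ?_
    rw [mul_left_comm, Finset.mul_sum]
    simp only [Finset.mul_sum]
  rw [e3]
  simp only [e2]
  rw [Finset.sum_const, Finset.card_univ, nsmul_eq_mul]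
  field_simp

lemma youngHom_conj {η : Type*} [Fintype η] (ws : η → ℕ) (g g' : ∀ i, Equiv.Perm (Fin (ws i)))
    (h : ∀ i, cycM (g i) = cycM (g' i)) : cycM (youngHom ws g) = cycM (youngHom ws g') := by
  have hc := fun i => isConj_iff.1 (isConj_of_cycM (h i))
  choose c hc using hc
  have : g' = c * g * c⁻¹ := by
    funext i
    exact (hc i).symm
  rw [this, map_mul, map_mul, map_inv, cycM_conj]

lemma zMult_ne {w : ℕ} (nu : Nat.Partition w) : (zMult nu.parts : ℚ) ≠ 0 := by
  have h := card_mul_zMult nu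
  intro h0
  rw [Nat.cast_eq_zero] at h0
  rw [h0, mul_zero] at h
  exact Nat.factorial_ne_zero _ h.symm

lemma card_div {w : ℕ} (nu : Nat.Partition w) :
    ((w.factorial : ℕ) : ℚ)⁻¹ *
      (Finset.univ.filter (fun g : Equiv.Perm (Fin w) => cycM g = nu.parts)).card
      = (zMult nu.parts : ℚ)⁻¹ := by
  have h := card_mul_zMult nu
  have hz := zMult_ne nu
  have hw : ((w.factorial : ℕ) : ℚ) ≠ 0 := by exact_mod_cast Nat.factorial_ne_zero w
  rw [inv_mul_eq_iff_eq_mul₀ hw, eq_mul_inv_iff_mul_eq₀ hz]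
  exact_mod_cast h

lemma avg_prod_if {η : Type*} [Fintype η] (ws : η → ℕ) (nu : ∀ i, Nat.Partition (ws i))
    (c : η → ℚ) :
    (Fintype.card (∀ i, Equiv.Perm (Fin (ws i))) : ℚ)⁻¹ *
      ∑ h : ∀ i, Equiv.Perm (Fin (ws i)), ∏ i, (if cycM (h i) = (nu i).parts then c i else 0)
      = ∏ i, (c i * (zMult (nu i).parts : ℚ)⁻¹) := by
  rw [← Fintype.prod_sum (fun i (σ : Equiv.Perm (Fin (ws i))) =>
    if cycM σ = (nu i).parts then c i else 0), Fintype.card_pi, Nat.cast_prod,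
    ← Finset.prod_inv_distrib, ← Finset.prod_mul_distrib]
  refine Finset.prod_congr rfl fun i _ => ?_
  rw [← card_div, Fintype.card_perm, Fintype.card_fin, ← Finset.sum_filter, Finset.sum_const,
    nsmul_eq_mul]
  ring

lemma pairCF_eval {η : Type*} [Fintype η] {a : ℕ} (lam : Nat.Partition a) (ws : η → ℕ)
    (nu : ∀ i, Nat.Partition (ws i)) (c : η → ℚ) (g : ∀ i, Equiv.Perm (Fin (ws i)))
    (hg : ∀ i, cycM (g i) = (nu i).parts) :
    pairCF (sFun lam) (multiProdCF ws rfl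
      (fun i σ => if cycM σ = (nu i).parts then c i else 0)) =
    (if a = ∑ i, ws i then sval lam.parts (cycM (youngHom ws g)) else 0) *
      ∏ i, (c i * (zMult (nu i).parts : ℚ)⁻¹) := by
  by_cases h : a = ∑ i, ws i
  · subst h
    rw [pairCF, dif_pos rfl, if_pos rfl]
    have e0 : (fun σ => multiProdCF ws rfl (fun i σ => if cycM σ = (nu i).parts then c i else 0)
        ((finCongr rfl).permCongr σ)) = IndFun (youngHom ws)
          (fun h => ∏ i, (if cycM (h i) = (nu i).parts then c i else 0)) := by
      funext σ
      rfl
    rw [e0, sp_IndFun _ _ _ (fun x g => by simp only [sFun, cycM_conj])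
      (fun g => by simp only [sFun, cycM_inv]), ← avg_prod_if]
    rw [mul_left_comm]
    refine congrArg _ ?_
    rw [Finset.mul_sum]
    refine Finset.sum_congr rfl fun h _ => ?_
    by_cases hh : ∀ i, cycM (h i) = (nu i).parts
    · rw [sFun, youngHom_conj ws h g (fun i => (hh i).trans (hg i).symm)]
    · push Not at hh
      obtain ⟨i, hi⟩ := hh
      rw [Finset.prod_eq_zero (Finset.mem_univ i) (if_neg hi), mul_zero, mul_zero]
  · rw [pairCF, dif_neg h, if_neg h, zero_mul]

/-- The function on `∏ S_{w(t,q)}` whose average is the size-`w` part of the entry. -/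
def Ffun {T Q : Type*} [Fintype T] [Fintype Q] (A : Matrix T Q ℤ)
    (lam : T → PttAll) (mu : Q → PttAll) (w : T × Q → ℕ)
    (g : ∀ x, Equiv.Perm (Fin (w x))) : ℚ :=
  (∏ t : T, (if (lam t).1 = ∑ q, w (t, q) then
      sval (lam t).2.parts (cycM (youngHom (fun q => w (t, q)) (fun q => g (t, q)))) else 0)) *
  (∏ q : Q, (if (mu q).1 = ∑ t, w (t, q) then
      sval (mu q).2.parts (cycM (youngHom (fun t => w (t, q)) (fun t => g (t, q)))) else 0)) *
  (∏ t : T, ∏ q : Q, (A t q : ℚ) ^ Multiset.card (cycM (g (t, q))))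

lemma VC_prod {G ι : Type*} [Group G] [Fintype ι] (f : ι → G → ℚ) (h : ∀ i, f i ∈ VC G) :
    (fun g => ∏ i, f i g) ∈ VC G := by
  have := (VC G).prod_mem (t := Finset.univ) (fun i _ => h i)
  convert this using 1
  funext g
  simp

lemma VC_ite {G : Type*} [Group G] (p : Prop) [Decidable p] (f : G → ℚ) (h : f ∈ VC G) :
    (fun g => if p then f g else 0) ∈ VC G := by
  split_ifs
  · exact h
  · exact zero_mem _

lemma Ffun_mem {T Q : Type*} [Fintype T] [Fintype Q] (A : Matrix T Q ℤ)
    (lam : T → PttAll) (mu : Q → PttAll) (w : T × Q → ℕ) :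
    Ffun A lam mu w ∈ VC (∀ x, Equiv.Perm (Fin (w x))) := by
  refine mul_mem (mul_mem
    (VC_prod (fun t (g : ∀ x, Equiv.Perm (Fin (w x))) => (if (lam t).1 = ∑ q, w (t, q) then
      sval (lam t).2.parts (cycM (youngHom (fun q => w (t, q)) (fun q => g (t, q)))) else 0))
      fun t => ?_)
    (VC_prod (fun q (g : ∀ x, Equiv.Perm (Fin (w x))) => (if (mu q).1 = ∑ t, w (t, q) then
      sval (mu q).2.parts (cycM (youngHom (fun t => w (t, q)) (fun t => g (t, q)))) else 0))
      fun q => ?_))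
    (VC_prod (fun t (g : ∀ x, Equiv.Perm (Fin (w x))) =>
      ∏ q : Q, (A t q : ℚ) ^ Multiset.card (cycM (g (t, q)))) fun t =>
      VC_prod (fun q (g : ∀ x, Equiv.Perm (Fin (w x))) =>
        (A t q : ℚ) ^ Multiset.card (cycM (g (t, q)))) fun q => ?_)
  · refine VC_ite (G := ∀ x, Equiv.Perm (Fin (w x))) _ _ ?_
    exact VC_comp ((youngHom (fun q => w (t, q))).comp
      (MonoidHom.mk' (fun g : ∀ x, Equiv.Perm (Fin (w x)) => fun q => g (t, q))
        (fun a b => rfl))) _ (sval_mem _ (lam t).2.parts)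
  · refine VC_ite (G := ∀ x, Equiv.Perm (Fin (w x))) _ _ ?_
    exact VC_comp ((youngHom (fun t => w (t, q))).comp
      (MonoidHom.mk' (fun g : ∀ x, Equiv.Perm (Fin (w x)) => fun t => g (t, q))
        (fun a b => rfl))) _ (sval_mem _ (mu q).2.parts)
  · exact VC_comp (MonoidHom.mk' (fun g : ∀ x, Equiv.Perm (Fin (w x)) => g (t, q))
        (fun a b => rfl)) _ (intPow_mem _ (A t q))

lemma Ffun_congr {T Q : Type*} [Fintype T] [Fintype Q] (A : Matrix T Q ℤ)
    (lam : T → PttAll) (mu : Q → PttAll) (w : T × Q → ℕ)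
    (g g' : ∀ x, Equiv.Perm (Fin (w x))) (h : ∀ x, cycM (g x) = cycM (g' x)) :
    Ffun A lam mu w g = Ffun A lam mu w g' := by
  unfold Ffun
  refine congrArg₂ (· * ·) (congrArg₂ (· * ·) (Finset.prod_congr rfl fun t _ => ?_)
    (Finset.prod_congr rfl fun q _ => ?_))
    (Finset.prod_congr rfl fun t _ => Finset.prod_congr rfl fun q _ => ?_)
  · rw [youngHom_conj _ (fun q => g (t, q)) (fun q => g' (t, q)) fun q => h (t, q)]
  · rw [youngHom_conj _ (fun t => g (t, q)) (fun t => g' (t, q)) fun t => h (t, q)]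
  · rw [h]

/-- The summand of `wrS`, with the sizes separated from the partitions. -/
def termW {T Q : Type*} [Fintype T] [Fintype Q] (A : Matrix T Q ℤ)
    (lam : T → PttAll) (mu : Q → PttAll) (w : T × Q → ℕ) (nu : ∀ x, Nat.Partition (w x)) : ℚ :=
  (∏ t : T, pairCF (sFun (lam t).2)
        (multiProdCF (fun q => w (t, q)) rfl (fun q => ptFun (nu (t, q))))) *
    (∏ q : Q, pairCF (sFun (mu q).2)
        (multiProdCF (fun t => w (t, q)) rfl (fun t => pFun (nu (t, q))))) *
    (∏ t : T, ∏ q : Q, (A t q : ℚ) ^ (Multiset.card (nu (t, q)).parts))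

lemma termW_eq {T Q : Type*} [Fintype T] [Fintype Q] (A : Matrix T Q ℤ)
    (lam : T → PttAll) (mu : Q → PttAll) (w : T × Q → ℕ) (nu : ∀ x, Nat.Partition (w x))
    (g : ∀ x, Equiv.Perm (Fin (w x))) (hg : ∀ x, cycM (g x) = (nu x).parts) :
    termW A lam mu w nu = Ffun A lam mu w g * ∏ x, (zMult (nu x).parts : ℚ)⁻¹ := by
  have h1 : ∀ t, pairCF (sFun (lam t).2)
        (multiProdCF (fun q => w (t, q)) rfl (fun q => ptFun (nu (t, q)))) = _ :=
    fun t => pairCF_eval (lam t).2 (fun q => w (t, q)) (fun q => nu (t, q)) (fun _ => 1)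
      (fun q => g (t, q)) (fun q => hg (t, q))
  have h2 : ∀ q, pairCF (sFun (mu q).2)
        (multiProdCF (fun t => w (t, q)) rfl (fun t => pFun (nu (t, q)))) = _ :=
    fun q => pairCF_eval (mu q).2 (fun t => w (t, q)) (fun t => nu (t, q))
      (fun t => (zMult (nu (t, q)).parts : ℚ))
      (fun t => g (t, q)) (fun t => hg (t, q))
  have h3 : ∀ x, (zMult (nu x).parts : ℚ) * (zMult (nu x).parts : ℚ)⁻¹ = 1 :=
    fun x => mul_inv_cancel₀ (zMult_ne _)
  rw [termW]
  simp only [h1, h2, h3, one_mul, mul_one, Finset.prod_const_one, Finset.prod_mul_distrib]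
  rw [Fintype.prod_prod_type, Ffun]
  simp only [hg]
  ring

lemma sum_termW {T Q : Type*} [Fintype T] [Fintype Q] (A : Matrix T Q ℤ)
    (lam : T → PttAll) (mu : Q → PttAll) (w : T × Q → ℕ) :
    ∑ nu : ∀ x, Nat.Partition (w x), termW A lam mu w nu =
      (Fintype.card (∀ x, Equiv.Perm (Fin (w x))) : ℚ)⁻¹ * ∑ g, Ffun A lam mu w g := by
  rw [← Finset.sum_fiberwise_of_maps_to (s := Finset.univ) (t := Finset.univ)
    (g := fun (g : ∀ x, Equiv.Perm (Fin (w x))) x => cycPart (g x)) (fun _ _ => Finset.mem_univ _),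
    Finset.mul_sum]
  refine Finset.sum_congr rfl fun nu _ => ?_
  choose g hg using fun x => exists_cycM (nu x)
  have e : (Fintype.card (∀ i, Equiv.Perm (Fin (w i))) : ℚ)⁻¹ *
      ∑ h : ∀ i, Equiv.Perm (Fin (w i)), ∏ i, (if cycM (h i) = (nu i).parts then (1 : ℚ) else 0)
      = ∏ i, (zMult (nu i).parts : ℚ)⁻¹ := by
    have e' := avg_prod_if w nu (fun _ => 1)
    simp only [one_mul] at e'
    convert e'
  rw [termW_eq A lam mu w nu g hg, ← e, mul_left_comm]
  refine congrArg _ ?_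
  rw [Finset.mul_sum, Finset.sum_filter]
  refine Finset.sum_congr rfl fun h _ => ?_
  by_cases hh : ∀ x, cycM (h x) = (nu x).parts
  · rw [if_pos (by funext x; exact Nat.Partition.ext (hh x)),
      Ffun_congr A lam mu w h g (fun x => (hh x).trans (hg x).symm)]
    simp [hh]
  · rw [if_neg (fun h' => hh fun x => congrArg Nat.Partition.parts (congrFun h' x))]
    push Not at hh
    obtain ⟨i, hi⟩ := hh
    rw [Finset.prod_eq_zero (Finset.mem_univ i) (if_neg hi), mul_zero]

/-- Separating sizes from partitions. -/
def sizeEquiv (X : Type*) : (Σ w : X → ℕ, ∀ x, Nat.Partition (w x)) ≃ (X → PttAll) where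
  toFun p x := ⟨p.1 x, p.2 x⟩
  invFun nu := ⟨fun x => (nu x).1, fun x => (nu x).2⟩
  left_inv _ := rfl
  right_inv _ := rfl

lemma wrS_eq {T Q : Type*} [Fintype T] [Fintype Q] (A : Matrix T Q ℤ)
    (lam : T → PttAll) (mu : Q → PttAll) :
    wrS (fun t q => (A t q : ℚ)) lam mu =
      ∑ᶠ p : (Σ w : T × Q → ℕ, ∀ x, Nat.Partition (w x)), termW A lam mu p.1 p.2 := by
  rw [wrS, wrGen]
  exact (finsum_comp_equiv (sizeEquiv (T × Q))).symm

lemma wrS_int {T Q : Type*} [Fintype T] [Fintype Q] (A : Matrix T Q ℤ)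
    (lam : T → PttAll) (mu : Q → PttAll) :
    ∃ k : ℤ, wrS (fun t q => (A t q : ℚ)) lam mu = (k : ℚ) := by
  let W : Finset (T × Q → ℕ) :=
    Fintype.piFinset (fun x => Finset.range ((lam x.1).1 + 1))
  have hsupp : Function.support (fun p : (Σ w : T × Q → ℕ, ∀ x, Nat.Partition (w x)) =>
      termW A lam mu p.1 p.2) ⊆ ((W.sigma fun w => Finset.univ :
        Finset (Σ w : T × Q → ℕ, ∀ x, Nat.Partition (w x))) : Set _) := by
    rintro ⟨w, nu⟩ hp
    rw [Finset.mem_coe, Finset.mem_sigma]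
    refine ⟨?_, Finset.mem_univ _⟩
    rw [Fintype.mem_piFinset]
    rintro ⟨t, q⟩
    rw [Finset.mem_range]
    by_contra hlt
    apply hp
    have hne : ¬ (lam t).1 = ∑ q, w (t, q) := by
      have := Finset.single_le_sum (f := fun q => w (t, q)) (fun _ _ => Nat.zero_le _)
        (Finset.mem_univ q)
      simp only at this hlt
      omega
    change termW A lam mu w nu = 0
    rw [termW, Finset.prod_eq_zero (Finset.mem_univ t) (by rw [pairCF, dif_neg hne]),
      zero_mul, zero_mul]
  rw [wrS_eq, finsum_eq_sum_of_support_subset _ hsupp, Finset.sum_sigma]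
  have : ∑ w ∈ W, ∑ nu : ∀ x, Nat.Partition (w x), termW A lam mu w nu
      ∈ (Int.castRingHom ℚ).range := by
    refine sum_mem fun w _ => ?_
    obtain ⟨k, hk⟩ := VC_avg _ (Ffun_mem A lam mu w)
    exact ⟨k, by rw [sum_termW, hk]; rfl⟩
  obtain ⟨k, hk⟩ := this
  exact ⟨k, hk.symm⟩

/-- **Lemma 3.10.** If `A` is an integer `T × Q`-matrix, then all the entries of `A^{≀}(s,s)`
are integers. -/
theorem wr_integer_entries {T Q : Type*} [Fintype T] [Fintype Q] (A : Matrix T Q ℤ)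
    (lam : T → PttAll) (mu : Q → PttAll) :
    ∃ k : ℤ, wrS (fun t q => (A t q : ℚ)) lam mu = (k : ℚ) := by
  exact wrS_int A lam mu

end
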